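/- (Boundary uniqueness, model wedge) Let W := {z ∈ ℂⁿ : Re z_j < 0 for j = 1,…,n} and E := iℝⁿ = {z ∈ ℂⁿ : Re z_j = 0 for j = 1,…,n}. Let u be plurisubharmonic on W and suppose that for every q ∈ E, u(z) → −∞ as W ∋ z → q. Then u ≡ −∞ on W. -/

import Mathlib

open Metric MeasureTheory Filter

noncomputable section

/-- Subharmonicity on a set `U ⊆ ℂ` for `[−∞,∞)`-valued functions, encoded with `EReal`:
`u` is upper semicontinuous, never `+∞`, and satisfies the sub-mean-value inequality
`u(a) ≤ (1/2π)∫₀^{2π} u(a+re^{iθ}) dθ` whenever the closed disc of centre `a` and radius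
`r` lies in `U`; the possibly `−∞`-valued mean is expressed through all real truncations
`max(u, −m)`, which is equivalent since the truncated means decrease to the mean. -/
def SubharmonicOn (u : ℂ → EReal) (U : Set ℂ) : Prop :=
  UpperSemicontinuousOn u U ∧ (∀ z ∈ U, u z ≠ ⊤) ∧
  ∀ a : ℂ, ∀ r : ℝ, 0 < r → closedBall a r ⊆ U → ∀ m : ℝ,
    u a ≤ (((1 / (2 * Real.pi)) * ∫ θ in (0:ℝ)..(2 * Real.pi),
      (max (u (a + r * Complex.exp (θ * Complex.I))) ((-m : ℝ) : EReal)).toReal : ℝ) : EReal)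

/-- Plurisubharmonicity on a set `Ω ⊆ ℂⁿ`: `u` is upper semicontinuous, never `+∞`, and
its restriction to every complex line is subharmonic on the corresponding open set. -/
def PlurisubharmonicOn {n : ℕ} (u : (Fin n → ℂ) → EReal) (Ω : Set (Fin n → ℂ)) : Prop :=
  UpperSemicontinuousOn u Ω ∧ (∀ z ∈ Ω, u z ≠ ⊤) ∧
  ∀ a V : Fin n → ℂ, SubharmonicOn (fun ζ : ℂ => u (a + ζ • V)) {ζ : ℂ | a + ζ • V ∈ Ω}

def gfun (z : ℂ) : ℝ := 2 * (z.re + 2) ^ 2 - z.im ^ 2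

lemma gfun_cont : Continuous gfun := by
  unfold gfun; fun_prop

lemma circ_re (a : ℂ) (r θ : ℝ) :
    (a + r * Complex.exp (θ * Complex.I)).re = a.re + r * Real.cos θ := by
  simp [Complex.exp_ofReal_mul_I_re]

lemma circ_im (a : ℂ) (r θ : ℝ) :
    (a + r * Complex.exp (θ * Complex.I)).im = a.im + r * Real.sin θ := by
  simp [Complex.exp_ofReal_mul_I_im]

lemma circ_mem (a : ℂ) (r θ : ℝ) (hr : 0 < r) :
    a + r * Complex.exp (θ * Complex.I) ∈ closedBall a r := by
  simp [Complex.norm_exp_ofReal_mul_I, abs_of_pos hr]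

lemma mean_g (a : ℂ) (r t C : ℝ) :
    (1 / (2 * Real.pi)) * ∫ θ in (0:ℝ)..(2 * Real.pi),
      (t + C * (gfun a - gfun (a + r * Complex.exp (θ * Complex.I)))) = t - C * r ^ 2 / 2 := by
  have h : ∀ θ : ℝ, t + C * (gfun a - gfun (a + r * Complex.exp (θ * Complex.I)))
      = (t + C * r ^ 2) + (-(4 * C * (a.re + 2) * r)) * Real.cos θ + (2 * C * a.im * r) * Real.sin θ
        + (-(3 * C * r ^ 2)) * Real.cos θ ^ 2 := by
    intro θ
    simp only [gfun, circ_re, circ_im]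
    have := Real.sin_sq_add_cos_sq θ
    linear_combination (C * r ^ 2) * this
  simp only [h]
  have i1 : IntervalIntegrable (fun θ : ℝ => (t + C * r ^ 2)) volume 0 (2 * Real.pi) :=
    Continuous.intervalIntegrable (by fun_prop) _ _
  rw [intervalIntegral.integral_add, intervalIntegral.integral_add, intervalIntegral.integral_add,
    intervalIntegral.integral_const_mul, intervalIntegral.integral_const_mul,
    intervalIntegral.integral_const_mul, integral_cos_sq, integral_cos, integral_sin]
  · simp
    field_simp
    ring
  all_goals exact Continuous.intervalIntegrable (by fun_prop) _ _

lemma strict_max (v : ℂ → EReal) (U : Set ℂ) (hv : SubharmonicOn v U) (a : ℂ) (r : ℝ)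
    (hr : 0 < r) (hU : closedBall a r ⊆ U) (t C : ℝ) (hC : 0 < C) (hva : v a = (t : EReal))
    (hle : ∀ z ∈ closedBall a r, v z ≤ ((t + C * (gfun a - gfun z) : ℝ) : EReal)) : False := by
  obtain ⟨husc, -, hmean⟩ := hv
  obtain ⟨m, hm⟩ := (isCompact_closedBall a r).exists_bound_of_continuousOn
    (f := fun z => t + C * (gfun a - gfun z))
    (by have := gfun_cont; fun_prop)
  have h1 := hmean a r hr hU m
  rw [hva, EReal.coe_le_coe_iff] at h1
  have hcont : Continuous fun θ : ℝ => a + r * Complex.exp (θ * Complex.I) := by fun_prop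
  have hmeas : Measurable fun θ : ℝ => v (a + r * Complex.exp (θ * Complex.I)) := by
    apply UpperSemicontinuous.measurable
    rw [← upperSemicontinuousOn_univ_iff]
    exact husc.comp hcont.continuousOn (fun θ _ => hU (circ_mem a r θ hr))
  have hpt : ∀ θ : ℝ, (max (v (a + r * Complex.exp (θ * Complex.I))) ((-m : ℝ) : EReal)).toReal
      ≤ t + C * (gfun a - gfun (a + r * Complex.exp (θ * Complex.I))) := by
    intro θ
    have hb := (abs_le.1 (hm _ (circ_mem a r θ hr))).1
    have h2 := max_le (hle _ (circ_mem a r θ hr)) (EReal.coe_le_coe_iff.2 hb)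
    have h3 := EReal.toReal_le_toReal h2
      (ne_of_gt (lt_of_lt_of_le (EReal.bot_lt_coe _) (le_max_right _ _))) (EReal.coe_ne_top _)
    rwa [EReal.toReal_coe] at h3
  have hpt2 : ∀ θ : ℝ, -m ≤ (max (v (a + r * Complex.exp (θ * Complex.I))) ((-m : ℝ) : EReal)).toReal := by
    intro θ
    have h3 := EReal.toReal_le_toReal (le_max_right (v (a + r * Complex.exp (θ * Complex.I))) ((-m : ℝ) : EReal))
      (EReal.coe_ne_bot _) (ne_of_lt (lt_of_le_of_lt (max_le (hle _ (circ_mem a r θ hr))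
        (EReal.coe_le_coe_iff.2 (abs_le.1 (hm _ (circ_mem a r θ hr))).1)) (EReal.coe_lt_top _)))
    simpa using h3
  have hint : IntervalIntegrable (fun θ : ℝ =>
      (max (v (a + r * Complex.exp (θ * Complex.I))) ((-m : ℝ) : EReal)).toReal)
      volume 0 (2 * Real.pi) := by
    rw [intervalIntegrable_iff]
    refine MeasureTheory.Measure.integrableOn_of_bounded (M := m) (by rw [Set.uIoc_of_le (by positivity), Real.volume_Ioc]; exact ENNReal.ofReal_ne_top) ?_ ?_
    · exact ((hmeas.max measurable_const).ereal_toReal).aestronglyMeasurable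
    · refine Filter.Eventually.of_forall fun θ => ?_
      rw [Real.norm_eq_abs]
      exact abs_le.2 ⟨hpt2 θ, (hpt θ).trans (abs_le.1 (hm _ (circ_mem a r θ hr))).2⟩
  have hint2 : IntervalIntegrable (fun θ : ℝ =>
      t + C * (gfun a - gfun (a + r * Complex.exp (θ * Complex.I)))) volume 0 (2 * Real.pi) := by
    have := gfun_cont
    exact Continuous.intervalIntegrable (by fun_prop) _ _
  have h4 := intervalIntegral.integral_mono_on (by positivity) hint hint2 (fun θ _ => hpt θ)
  have h5 := mul_le_mul_of_nonneg_left h4 (show 0 ≤ 1 / (2 * Real.pi) by positivity)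
  rw [mean_g] at h5
  have : 0 < C * r ^ 2 := by positivity
  linarith

lemma half_plane (v : ℂ → EReal) (hv : SubharmonicOn v {z : ℂ | z.re < 0})
    (hlim : ∀ q : ℂ, q.re = 0 → Tendsto v (nhdsWithin q {z : ℂ | z.re < 0}) (nhds ⊥)) :
    v (-1) = ⊥ := by
  classical
  by_contra hne
  set K : Set ℂ := Set.Icc (-2) 0 ×ℂ Set.Icc (-3) 3 with hK
  have hKc : IsCompact K := isCompact_Icc.reProdIm isCompact_Icc
  have hKmem : ∀ z : ℂ, z ∈ K ↔ (-2 ≤ z.re ∧ z.re ≤ 0) ∧ (-3 ≤ z.im ∧ z.im ≤ 3) := by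
    intro z; simp [hK, Complex.mem_reProdIm]
  have h1K : (-1 : ℂ) ∈ K := by rw [hKmem]; norm_num
  set vt : ℂ → EReal := fun z => if z.re < 0 then v z else ⊥ with hvt
  have hvtop : ∀ z, vt z ≠ ⊤ := by
    intro z
    simp only [hvt]
    split_ifs with h
    · exact hv.2.1 z h
    · simp
  have hopen : IsOpen {z : ℂ | z.re < 0} := isOpen_lt Complex.continuous_re continuous_const
  have husc : UpperSemicontinuousOn vt K := by
    intro q hq y hy
    rcases lt_or_eq_of_le ((hKmem q).1 hq).1.2 with h | h
    · have h1 : v q < y := by simpa [hvt, h] using hy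
      have h2 := hv.1 q h y h1
      rw [hopen.nhdsWithin_eq h] at h2
      apply mem_nhdsWithin_of_mem_nhds
      filter_upwards [h2, hopen.mem_nhds h] with z hz hz2
      simpa [hvt, show z.re < 0 from hz2] using hz
    · have h1 : ⊥ < y := by simpa [hvt, h] using hy
      have h2 := (hlim q h).eventually (gt_mem_nhds h1)
      rw [eventually_nhdsWithin_iff] at h2
      apply mem_nhdsWithin_of_mem_nhds
      filter_upwards [h2] with z hz
      by_cases hz2 : z.re < 0
      · simpa [hvt, hz2] using hz hz2
      · simpa [hvt, hz2] using h1
  obtain ⟨p0, hp0, hmax0⟩ := husc.exists_isMaxOn ⟨_, h1K⟩ hKc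
  have hv1 : vt (-1) = v (-1) := by simp [hvt]
  obtain ⟨t, ht⟩ : ∃ t : ℝ, v (-1) = (t : EReal) :=
    ⟨(v (-1)).toReal, (EReal.coe_toReal (hv1 ▸ hvtop (-1)) hne).symm⟩
  have hle0 : ∀ z ∈ K, vt z ≤ vt p0 := fun z hz => hmax0 hz
  have hp0b : vt p0 ≠ ⊥ := by
    intro h
    have := hle0 _ h1K
    rw [h, hv1, ht] at this
    simp at this
  obtain ⟨M, hM⟩ : ∃ M : ℝ, vt p0 = (M : EReal) :=
    ⟨(vt p0).toReal, (EReal.coe_toReal (hvtop _) hp0b).symm⟩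
  rw [hM] at hle0
  set C : ℝ := |M - t| + 1 with hCdef
  have hC : 0 < C := by positivity
  have hCM : M < t + 2 * C := by
    have := le_abs_self (M - t)
    have := abs_nonneg (M - t)
    linarith
  have hwusc : UpperSemicontinuousOn (fun z => vt z + ((C * gfun z : ℝ) : EReal)) K := by
    refine husc.add' ?_ ?_
    · refine ContinuousOn.upperSemicontinuousOn (Continuous.continuousOn ?_)
      exact continuous_coe_real_ereal.comp (continuous_const.mul gfun_cont)
    · intro x _
      exact EReal.continuousAt_add (Or.inl (hvtop x)) (Or.inr (EReal.coe_ne_top _))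
  obtain ⟨a, haK, hamax⟩ := hwusc.exists_isMaxOn ⟨_, h1K⟩ hKc
  have hale : ∀ z ∈ K, vt z + ((C * gfun z : ℝ) : EReal) ≤ vt a + ((C * gfun a : ℝ) : EReal) :=
    fun z hz => hamax hz
  have ha1 := hale _ h1K
  have hg1 : gfun (-1) = 2 := by simp [gfun]; norm_num
  rw [hv1, ht, hg1, ← EReal.coe_add] at ha1
  have hab : vt a ≠ ⊥ := by
    intro h
    rw [h, EReal.bot_add] at ha1
    exact EReal.coe_ne_bot _ (le_bot_iff.1 ha1)
  obtain ⟨s, hs⟩ : ∃ s : ℝ, vt a = (s : EReal) :=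
    ⟨(vt a).toReal, (EReal.coe_toReal (hvtop _) hab).symm⟩
  have hare : a.re < 0 := by
    by_contra h
    exact hab (by simp [hvt, h])
  rw [hs, ← EReal.coe_add, EReal.coe_le_coe_iff] at ha1
  have hsM := hle0 a haK
  rw [hs, EReal.coe_le_coe_iff] at hsM
  have hga : 0 < gfun a := by
    have : 0 < C * gfun a := by linarith
    exact pos_of_mul_pos_right this hC.le
  have haK' := (hKmem a).1 haK
  have hva : v a = (s : EReal) := by rw [← hs]; simp [hvt, hare]
  have hO : Set.Ioo (-2) 0 ×ℂ Set.Ioo (-3) 3 ∈ nhds a := by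
    apply (isOpen_Ioo.reProdIm isOpen_Ioo).mem_nhds
    rw [Complex.mem_reProdIm]
    unfold gfun at hga
    obtain ⟨⟨h1, h2⟩, h3, h4⟩ := haK'
    refine ⟨⟨?_, hare⟩, ?_, ?_⟩
    · rcases lt_or_eq_of_le h1 with h | h
      · exact h
      · rw [← h] at hga; nlinarith [sq_nonneg a.im]
    · nlinarith
    · nlinarith
  obtain ⟨r, hr, hrO⟩ := Metric.nhds_basis_closedBall.mem_iff.1 hO
  refine strict_max v _ hv a r hr (fun z hz => ?_) s C hC hva (fun z hz => ?_)
  · exact (hrO hz).1.2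
  · have hzO := hrO hz
    rw [Complex.mem_reProdIm] at hzO
    have hzre : z.re < 0 := hzO.1.2
    have hz := hale z ((hKmem z).2 ⟨⟨hzO.1.1.le, hzO.1.2.le⟩, hzO.2.1.le, hzO.2.2.le⟩)
    have hvz : vt z = v z := by simp [hvt, hzre]
    rw [hvz, hs, ← EReal.coe_add] at hz
    by_cases hb : v z = ⊥
    · rw [hb]; exact bot_le
    · rw [← EReal.coe_toReal (hvz ▸ hvtop z) hb] at hz ⊢
      rw [← EReal.coe_add, EReal.coe_le_coe_iff] at hz
      rw [EReal.coe_le_coe_iff]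
      linarith

/-- boundary uniqueness, model wedge: a plurisubharmonic function on the
wedge `W = {Re z_j < 0 ∀j}` tending to `−∞` at every point of the edge `E = iℝⁿ` is
identically `−∞`. -/
theorem boundary_uniqueness_model_wedge
    (n : ℕ) (u : (Fin n → ℂ) → EReal)
    (hpsh : PlurisubharmonicOn u {z : Fin n → ℂ | ∀ j, (z j).re < 0})
    (hlim : ∀ q : Fin n → ℂ, (∀ j, (q j).re = 0) →
      Tendsto u (nhdsWithin q {z : Fin n → ℂ | ∀ j, (z j).re < 0}) (nhds ⊥)) :
    ∀ z : Fin n → ℂ, (∀ j, (z j).re < 0) → u z = ⊥ := by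
  intro p hp
  rcases Nat.eq_zero_or_pos n with hn | hn
  · subst hn
    have h := hlim p (fun j => j.elim0)
    have h2 : Tendsto u (pure p) (nhds ⊥) :=
      h.mono_left (pure_le_nhdsWithin hp)
    exact tendsto_nhds_unique (tendsto_pure_nhds u p) h2
  · set a : Fin n → ℂ := fun j => ((p j).im : ℂ) * Complex.I with ha
    set V : Fin n → ℂ := fun j => ((-(p j).re : ℝ) : ℂ) with hV
    have hre : ∀ (ζ : ℂ) (j : Fin n), ((a + ζ • V) j).re = ζ.re * (-(p j).re) := by
      intro ζ j
      simp [ha, hV]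
    have hset : {ζ : ℂ | a + ζ • V ∈ {z : Fin n → ℂ | ∀ j, (z j).re < 0}} = {ζ : ℂ | ζ.re < 0} := by
      ext ζ
      simp only [Set.mem_ofPred_eq, hre]
      constructor
      · intro h
        have h1 := h ⟨0, hn⟩
        have h2 := hp ⟨0, hn⟩
        by_contra h3
        nlinarith
      · intro h j
        nlinarith [hp j]
    have hsub := hpsh.2.2 a V
    rw [hset] at hsub
    have key := half_plane _ hsub ?_
    · have hpe : a + (-1 : ℂ) • V = p := by
        ext j
        apply Complex.ext <;> simp [ha, hV]
      simpa only [hpe] using key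
    · intro q hq
      refine (hlim (a + q • V) (fun j => by rw [hre, hq, zero_mul])).comp ?_
      refine tendsto_nhdsWithin_iff.2 ⟨?_, ?_⟩
      · have : Continuous fun ζ : ℂ => a + ζ • V := by fun_prop
        exact this.continuousAt.tendsto.mono_left nhdsWithin_le_nhds
      · filter_upwards [self_mem_nhdsWithin] with ζ hζ
        have h := Set.ext_iff.1 hset ζ
        exact h.2 hζ
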